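/- arXiv:1509.06023 — 2 statements merged into one kernel-verified Lean document; each statement's English description precedes it below -/
import Mathlib

section
/- For k ≠ k' (k, k' ≥ 1, d ≥ 3), the cones K_k = conv({0_d} ∪ ({1} × B_{k+1}^{d-1})) and K_{k'} = conv({0_d} ∪ ({1} × B_{k'+1}^{d-1})) are not affinely equivalent: there is no invertible affine map T with T(K_k) = K_{k'}. -/
def coneK (d k : ℕ) : Set (ℝ × EuclideanSpace ℝ (Fin (d - 1))) :=
  convexHull ℝ ({(0, 0)} ∪
    {p : ℝ × EuclideanSpace ℝ (Fin (d - 1)) | p.1 = 1 ∧ ∑ i, |p.2 i| ^ (k + 1) ≤ 1})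

/-- The `p`-th power of the `ℓ_p` norm on `ℝⁿ`. -/
noncomputable def powSum {n : ℕ} (p : ℕ) (x : EuclideanSpace ℝ (Fin n)) : ℝ := ∑ i, |x i| ^ p

lemma powSum_nonneg {n : ℕ} (p : ℕ) (x : EuclideanSpace ℝ (Fin n)) : 0 ≤ powSum p x :=
  Finset.sum_nonneg fun _ _ => by positivity

lemma powSum_zero {n p : ℕ} (hp : p ≠ 0) : powSum p (0 : EuclideanSpace ℝ (Fin n)) = 0 := by
  simp [powSum, hp]

lemma powSum_neg {n : ℕ} (p : ℕ) (x : EuclideanSpace ℝ (Fin n)) :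
    powSum p (-x) = powSum p x := by
  simp [powSum]

lemma powSum_smul {n : ℕ} (p : ℕ) {c : ℝ} (hc : 0 ≤ c) (x : EuclideanSpace ℝ (Fin n)) :
    powSum p (c • x) = c ^ p * powSum p x := by
  simp [powSum, Finset.mul_sum, abs_mul, mul_pow, abs_of_nonneg hc]

lemma powSum_single {n p : ℕ} (hp : p ≠ 0) (i : Fin n) :
    powSum p (EuclideanSpace.single i (1 : ℝ)) = 1 := by
  rw [powSum, Finset.sum_eq_single i]
  · simp
  · intro j _ hj
    simp [hj, hp]
  · simp

lemma powSum_single_add_smul_single {n p : ℕ} (hp : p ≠ 0) {i j : Fin n} (hij : i ≠ j)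
    {t : ℝ} (ht : 0 ≤ t) :
    powSum p (EuclideanSpace.single i (1 : ℝ) + t • EuclideanSpace.single j (1 : ℝ))
      = 1 + t ^ p := by
  rw [powSum, Fintype.sum_eq_add i j hij]
  · simp [hij, hij.symm, abs_of_nonneg ht]
  · rintro l ⟨h1, h2⟩
    simp [h1, h2, hp]

lemma convex_powSum_le_one {n p : ℕ} :
    Convex ℝ {x : EuclideanSpace ℝ (Fin n) | powSum p x ≤ 1} := by
  have key : ConvexOn ℝ Set.univ fun x : EuclideanSpace ℝ (Fin n) => powSum p x := by
    refine ⟨convex_univ, fun x _ y _ a b ha hb hab => ?_⟩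
    simp only [powSum, smul_eq_mul, Finset.mul_sum, ← Finset.sum_add_distrib]
    refine Finset.sum_le_sum fun i _ => ?_
    have h1 : |(a • x + b • y) i| ≤ a * |x i| + b * |y i| := by
      simpa [abs_mul, abs_of_nonneg ha, abs_of_nonneg hb] using abs_add_le (a * x i) (b * y i)
    exact (pow_le_pow_left₀ (abs_nonneg _) h1 p).trans
      ((convexOn_pow p).2 (abs_nonneg (x i)) (abs_nonneg (y i)) ha hb hab)
  simpa using key.convex_le 1

lemma mem_coneK {d k : ℕ} {u : ℝ × EuclideanSpace ℝ (Fin (d - 1))} :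
    u ∈ coneK d k ↔ ∃ s : ℝ, 0 ≤ s ∧ s ≤ 1 ∧ ∃ y, powSum (k + 1) y ≤ 1 ∧ u = (s, s • y) := by
  have hconv : Convex ℝ {p : ℝ × EuclideanSpace ℝ (Fin (d - 1)) |
      p.1 = 1 ∧ ∑ i, |p.2 i| ^ (k + 1) ≤ 1} := by
    have := (convex_singleton (1 : ℝ) (𝕜 := ℝ)).prod
      (convex_powSum_le_one (n := d - 1) (p := k + 1))
    convert this using 1
    ext ⟨r, x⟩
    simp [powSum]
  have hne : {p : ℝ × EuclideanSpace ℝ (Fin (d - 1)) |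
      p.1 = 1 ∧ ∑ i, |p.2 i| ^ (k + 1) ≤ 1}.Nonempty := ⟨(1, 0), by simp⟩
  rw [coneK, Set.singleton_union, convexHull_insert hne, hconv.convexHull_eq, mem_convexJoin]
  constructor
  · rintro ⟨_, rfl, ⟨r, y⟩, ⟨hr, hy⟩, a, b, ha, hb, hab, rfl⟩
    dsimp only at hr
    subst hr
    exact ⟨b, hb, by linarith, y, hy, by simp⟩
  · rintro ⟨s, hs, hs1, y, hy, rfl⟩
    exact ⟨_, rfl, (1, y), ⟨rfl, hy⟩, 1 - s, s, by linarith, hs, by ring, by simp⟩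

lemma one_mk_mem_coneK {d k : ℕ} {x : EuclideanSpace ℝ (Fin (d - 1))} :
    ((1 : ℝ), x) ∈ coneK d k ↔ powSum (k + 1) x ≤ 1 := by
  rw [mem_coneK]
  constructor
  · rintro ⟨s, -, -, y, hy, h⟩
    obtain ⟨rfl, rfl⟩ := Prod.mk.inj h
    simpa using hy
  · exact fun h => ⟨1, by simp, le_rfl, x, h, by simp⟩

lemma zero_mem_coneK {d k : ℕ} : (0 : ℝ × EuclideanSpace ℝ (Fin (d - 1))) ∈ coneK d k :=
  mem_coneK.2 ⟨0, le_rfl, zero_le_one, 0, by simp [powSum], by ext1 <;> simp⟩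

lemma fst_le_one_of_mem_coneK {d k : ℕ} {u : ℝ × EuclideanSpace ℝ (Fin (d - 1))}
    (hu : u ∈ coneK d k) : u.1 ≤ 1 := by
  obtain ⟨s, -, h, y, -, rfl⟩ := mem_coneK.1 hu
  exact h

lemma zero_mem_extremePoints_coneK {d k : ℕ} :
    (0 : ℝ × EuclideanSpace ℝ (Fin (d - 1))) ∈ (coneK d k).extremePoints ℝ := by
  refine ⟨zero_mem_coneK, ?_⟩
  rintro u hu v hv ⟨a, b, ha, hb, hab, h⟩
  obtain ⟨s, hs, -, y, -, rfl⟩ := mem_coneK.1 hu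
  obtain ⟨r, hr, -, z, -, rfl⟩ := mem_coneK.1 hv
  have h1 : a * s + b * r = 0 := by simpa using congrArg Prod.fst h
  have : s = 0 := by nlinarith [mul_nonneg ha.le hs, mul_nonneg hb.le hr, mul_pos ha hb]
  simp [this]

lemma fst_eq_one_of_mem_extremePoints_coneK {d k : ℕ}
    {u : ℝ × EuclideanSpace ℝ (Fin (d - 1))}
    (hu : u ∈ (coneK d k).extremePoints ℝ) (h0 : u ≠ 0) : u.1 = 1 := by
  rcases extremePoints_convexHull_subset hu with h | h
  · exact absurd h h0
  · exact h.1

lemma neg_snd_mem_coneK {d k : ℕ} {u : ℝ × EuclideanSpace ℝ (Fin (d - 1))}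
    (hu : u ∈ coneK d k) : (u.1, -u.2) ∈ coneK d k := by
  obtain ⟨s, hs, hs1, y, hy, rfl⟩ := mem_coneK.1 hu
  exact mem_coneK.2 ⟨s, hs, hs1, -y, by rwa [powSum_neg], by simp⟩

lemma neg_snd_mem_extremePoints_coneK {d k : ℕ} {u : ℝ × EuclideanSpace ℝ (Fin (d - 1))}
    (hu : u ∈ (coneK d k).extremePoints ℝ) :
    (u.1, -u.2) ∈ (coneK d k).extremePoints ℝ := by
  refine ⟨neg_snd_mem_coneK hu.1, ?_⟩
  rintro v hv w hw ⟨a, b, ha, hb, hab, h⟩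
  have := hu.2 (neg_snd_mem_coneK hv) (neg_snd_mem_coneK hw) ⟨a, b, ha, hb, hab, by
    ext1
    · simpa using congrArg Prod.fst h
    · have h2 : a • v.2 + b • w.2 = -u.2 := by simpa using congrArg Prod.snd h
      simp only [Prod.snd_add, Prod.smul_snd, smul_neg]
      rw [← neg_add, h2, neg_neg]⟩
  rw [← this]
  simp

lemma AffineEquiv.map_mem_extremePoints {E F : Type*} [AddCommGroup E] [Module ℝ E]
    [AddCommGroup F] [Module ℝ F] (T : E ≃ᵃ[ℝ] F) {s : Set E} {x : E}
    (hx : x ∈ s.extremePoints ℝ) : T x ∈ (T '' s).extremePoints ℝ := by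
  refine ⟨⟨x, hx.1, rfl⟩, ?_⟩
  rintro _ ⟨y, hy, rfl⟩ _ ⟨z, hz, rfl⟩ h
  have h' : T x ∈ T.toAffineMap '' openSegment ℝ y z := by
    rw [image_openSegment]
    exact h
  obtain ⟨w, hw, hwx⟩ := h'
  rw [T.injective hwx] at hw
  rw [hx.2 hy hz hw]

lemma exists_smul_eq_of_add_eq_extremePoint {d k : ℕ}
    {u v w : ℝ × EuclideanSpace ℝ (Fin (d - 1))}
    (hw : w ∈ (coneK d k).extremePoints ℝ) (h0 : w ≠ 0)
    (hu : u ∈ coneK d k) (hv : v ∈ coneK d k) (h : u + v = w) : ∃ a : ℝ, u = a • w := by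
  have h1 := fst_eq_one_of_mem_extremePoints_coneK hw h0
  obtain ⟨s, hs, -, y, hy, rfl⟩ := mem_coneK.1 hu
  obtain ⟨r, hr, -, z, hz, rfl⟩ := mem_coneK.1 hv
  have hsr : s + r = 1 := by rw [← h1, ← h]; simp
  rcases hs.eq_or_lt with rfl | hs
  · exact ⟨0, by simp⟩
  rcases hr.eq_or_lt with rfl | hr
  · exact ⟨1, by rw [← h]; simp⟩
  refine ⟨s, ?_⟩
  rw [← hw.2 (one_mk_mem_coneK.2 hy) (one_mk_mem_coneK.2 hz)
    ⟨s, r, hs, hr, hsr, by rw [← h]; simp⟩]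
  simp

lemma exists_single_not_smul {n : ℕ} (hn : 2 ≤ n) (x : EuclideanSpace ℝ (Fin n)) :
    ∃ i : Fin n, ∀ c : ℝ, EuclideanSpace.single i (1 : ℝ) ≠ c • x := by
  by_contra! H
  obtain ⟨c, hc⟩ := H ⟨0, by lia⟩
  obtain ⟨c', hc'⟩ := H ⟨1, by lia⟩
  have h1 := congrArg (fun v => v ⟨0, by lia⟩) hc
  have h2 := congrArg (fun v => v ⟨1, by lia⟩) hc
  have h3 := congrArg (fun v => v ⟨1, by lia⟩) hc'
  simp at h1 h2 h3
  rcases h2 with h2 | h2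
  · simp [h2] at h1
  · simp [h2] at h3

/-- An affine equivalence between two of the cones maps apex to apex. -/
lemma map_zero_of_image_coneK {d k k' : ℕ} (hd : 3 ≤ d)
    (T : (ℝ × EuclideanSpace ℝ (Fin (d - 1))) ≃ᵃ[ℝ] (ℝ × EuclideanSpace ℝ (Fin (d - 1))))
    (hT : T '' coneK d k = coneK d k') : T 0 = 0 := by
  by_contra h0
  have hsymm : T.symm '' coneK d k' = coneK d k := by
    rw [← hT, Set.image_image]; simp
  have hv : T 0 ∈ (coneK d k').extremePoints ℝ := hT ▸ T.map_mem_extremePoints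
    zero_mem_extremePoints_coneK
  have hv1 := fst_eq_one_of_mem_extremePoints_coneK hv h0
  obtain ⟨x, hx⟩ : ∃ x, T 0 = (1, x) := ⟨(T 0).2, by rw [← hv1]⟩
  have hv' := neg_snd_mem_extremePoints_coneK hv
  rw [hx] at hv'
  dsimp only at hv'
  have hV' : T.symm (1, -x) ∈ (coneK d k).extremePoints ℝ :=
    hsymm ▸ T.symm.map_mem_extremePoints hv'
  obtain ⟨i, hi⟩ := exists_single_not_smul (show 2 ≤ d - 1 by lia) x
  set y := EuclideanSpace.single i (1 : ℝ)
  have hy1 : powSum (k' + 1) y = 1 := powSum_single (by simp) i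
  have hW : T.symm (1, y) ∈ coneK d k :=
    hsymm ▸ Set.mem_image_of_mem _ (one_mk_mem_coneK.2 hy1.le)
  have hW' : T.symm (1, -y) ∈ coneK d k :=
    hsymm ▸ Set.mem_image_of_mem _ (one_mk_mem_coneK.2 (by rw [powSum_neg, hy1]))
  have hlin : ∀ z, T z = T.linear z + (1, x) := fun z => by
    rw [← hx]; simpa using T.map_vadd 0 z
  have hlin' : ∀ z, T.linear (T.symm z) = z - (1, x) := fun z => by
    rw [eq_sub_iff_add_eq, ← hlin]; simp
  have hne : T.symm (1, -x) ≠ 0 := by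
    intro h
    rw [T.symm_apply_eq, hx] at h
    have h2 : -x = x := congrArg Prod.snd h
    have hx0 : x = 0 := by
      have : (2 : ℝ) • x = 0 := by rw [two_smul]; nth_rw 1 [← h2]; simp
      simpa using this
    rw [hx, hx0] at hv
    have hmid := hv.2 (one_mk_mem_coneK.2 hy1.le)
      (one_mk_mem_coneK.2 (show powSum (k' + 1) (-y) ≤ 1 by rw [powSum_neg, hy1]))
      ⟨1 / 2, 1 / 2, by norm_num, by norm_num, by norm_num, by ext1 <;> norm_num⟩
    exact hi 0 (by simpa using congrArg Prod.snd hmid)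
  have hsum : T.symm (1, y) + T.symm (1, -y) = T.symm (1, -x) := by
    apply T.linear.injective
    rw [map_add, hlin', hlin', hlin']
    ext1
    · simp
    · simp only [Prod.snd_add, Prod.snd_sub]
      abel
  obtain ⟨a, ha⟩ := exists_smul_eq_of_add_eq_extremePoint hV' hne hW hW' hsum
  have := congrArg T.linear ha
  rw [map_smul, hlin', hlin'] at this
  have h2 : y - x = a • (-x - x) := congrArg Prod.snd this
  refine hi (1 - 2 * a) ?_
  rw [eq_add_of_sub_eq h2]
  module

/-- A linear equivalence between two of the cones maps base to base. -/
lemma fst_map_of_image_coneK {d k k' : ℕ}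
    (L : (ℝ × EuclideanSpace ℝ (Fin (d - 1))) ≃ₗ[ℝ] (ℝ × EuclideanSpace ℝ (Fin (d - 1))))
    (hL : ∀ u, L u ∈ coneK d k' ↔ u ∈ coneK d k)
    {x : EuclideanSpace ℝ (Fin (d - 1))} (hx : powSum (k + 1) x ≤ 1) : (L (1, x)).1 = 1 := by
  obtain ⟨s, hs, hs1, y, hy, h⟩ := mem_coneK.1 ((hL _).2 (one_mk_mem_coneK.2 hx))
  have hs0 : s ≠ 0 := by
    rintro rfl
    have : ((1 : ℝ), x) = 0 := L.injective (by rw [h]; simp)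
    simpa using congrArg Prod.fst this
  have hpre : L (s⁻¹ • (1, x)) = (1, y) := by
    rw [map_smul, h]
    simp [hs0]
  have hmem := (hL (s⁻¹ • (1, x))).1 (hpre ▸ one_mk_mem_coneK.2 hy)
  have hle : s⁻¹ ≤ 1 := by simpa using fst_le_one_of_mem_coneK hmem
  rw [h]
  exact le_antisymm hs1 ((inv_le_one₀ (lt_of_le_of_ne hs hs0.symm)).1 hle)

lemma exists_pos_pow_mul_eq {p : ℕ} (hp : p ≠ 0) {a b : ℝ} (ha : 0 < a) (hb : 0 < b) :
    ∃ c : ℝ, 0 < c ∧ c ^ p * a = b := by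
  refine ⟨(b / a) ^ ((p : ℝ)⁻¹), by positivity, ?_⟩
  rw [Real.rpow_inv_natCast_pow (by positivity) hp]
  field_simp

lemma eq_zero_of_translate_mem {n q : ℕ} (hq : q ≠ 0) {v : EuclideanSpace ℝ (Fin n)}
    (h : ∀ z, powSum q z ≤ 1 → powSum q (z + v) ≤ 1) : v = 0 := by
  have hm : ∀ m : ℕ, powSum q ((m : ℝ) • v) ≤ 1 := by
    intro m
    induction m with
    | zero => simp [powSum_zero hq]
    | succ m ih =>
      have := h _ ih
      rwa [show (m : ℝ) • v + v = ((m + 1 : ℕ) : ℝ) • v by push_cast; module] at this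
  ext i
  by_contra hi
  have hi : 0 < |v i| := abs_pos.2 hi
  obtain ⟨m, hm'⟩ := exists_nat_gt (1 / |v i|)
  have h1 : 1 < |((m : ℝ) • v) i| := by
    simp only [PiLp.smul_apply, smul_eq_mul, abs_mul, Nat.abs_cast]
    rwa [div_lt_iff₀ hi] at hm'
  have h2 : |((m : ℝ) • v) i| ^ q ≤ powSum q ((m : ℝ) • v) :=
    Finset.single_le_sum (f := fun i => |((m : ℝ) • v) i| ^ q)
      (fun _ _ => by positivity) (Finset.mem_univ i)
  linarith [hm m, one_lt_pow₀ h1 hq]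

lemma pow_le_pow_of_le_one_imp {E : Type*} [AddCommGroup E] [Module ℝ E] {p q : ℕ}
    (hp : p ≠ 0) (hq : q ≠ 0) {f g : E → ℝ} (hf0 : ∀ x, 0 ≤ f x) (hg0 : ∀ x, 0 ≤ g x)
    (hf : ∀ (c : ℝ) x, 0 ≤ c → f (c • x) = c ^ p * f x)
    (hg : ∀ (c : ℝ) x, 0 ≤ c → g (c • x) = c ^ q * g x)
    (h : ∀ x, f x ≤ 1 → g x ≤ 1) (x : E) : g x ^ p ≤ f x ^ q := by
  rcases (hf0 x).eq_or_lt with h0 | h0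
  · rcases (hg0 x).eq_or_lt with h1 | h1
    · simp [← h0, ← h1, hp, hq]
    · obtain ⟨c, hc, hcg⟩ := exists_pos_pow_mul_eq hq h1 zero_lt_two
      have := h (c • x) (by rw [hf c x hc.le, ← h0]; simp)
      rw [hg c x hc.le, hcg] at this
      norm_num at this
  · obtain ⟨c, hc, hcf⟩ := exists_pos_pow_mul_eq hp h0 one_pos
    have h1 := h (c • x) (by rw [hf c x hc.le, hcf])
    rw [hg c x hc.le] at h1
    have h2 : (c ^ q * g x) ^ p ≤ (c ^ p * f x) ^ q := by
      rw [hcf, one_pow]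
      exact pow_le_one₀ (mul_nonneg (by positivity) (hg0 x)) h1
    rw [mul_pow, mul_pow, ← pow_mul, ← pow_mul, mul_comm p q] at h2
    exact le_of_mul_le_mul_left h2 (by positivity)

lemma abs_add_pow_add_abs_sub_pow_ge (m : ℕ) (a s : ℝ) :
    2 * |a| ^ (m + 2) + 2 * (|a| ^ m * s ^ 2) ≤ |a + s| ^ (m + 2) + |a - s| ^ (m + 2) := by
  set u := |a + s| with hu
  set v := |a - s| with hv
  have hu0 : 0 ≤ u := abs_nonneg _
  have hv0 : 0 ≤ v := abs_nonneg _
  have huv : u ^ 2 + v ^ 2 = 2 * (|a| ^ 2 + s ^ 2) := by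
    rw [hu, hv, sq_abs, sq_abs, sq_abs]; ring
  have hmean : 2 * |a| ^ m ≤ u ^ m + v ^ m := by
    have h1 : |a| ≤ (1 / 2 : ℝ) * u + (1 / 2 : ℝ) * v := by
      have := abs_add_le (a + s) (a - s)
      rw [show a + s + (a - s) = 2 * a by ring, abs_mul, abs_two] at this
      linarith
    have h2 := (pow_le_pow_left₀ (abs_nonneg a) h1 m).trans
      ((convexOn_pow m).2 hu0 hv0 (by norm_num : (0 : ℝ) ≤ 1 / 2)
        (by norm_num : (0 : ℝ) ≤ 1 / 2) (by norm_num))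
    simp only [smul_eq_mul] at h2
    linarith
  have hcheb : 0 ≤ (u ^ m - v ^ m) * (u ^ 2 - v ^ 2) := by
    rcases le_total u v with h | h
    · exact mul_nonneg_of_nonpos_of_nonpos
        (sub_nonpos.2 (pow_le_pow_left₀ hu0 h m)) (sub_nonpos.2 (pow_le_pow_left₀ hu0 h 2))
    · exact mul_nonneg
        (sub_nonneg.2 (pow_le_pow_left₀ hv0 h m)) (sub_nonneg.2 (pow_le_pow_left₀ hv0 h 2))
  have hprod := mul_le_mul_of_nonneg_right hmean (by positivity : 0 ≤ u ^ 2 + v ^ 2)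
  rw [huv] at hprod
  have hexp : (u ^ m + v ^ m) * (2 * (|a| ^ 2 + s ^ 2))
      ≤ 2 * (u ^ m * u ^ 2 + v ^ m * v ^ 2) := by
    rw [← huv]
    linarith
  rw [pow_add, pow_add, pow_add]
  linarith

lemma one_add_pow_le (q : ℕ) {r : ℝ} (hr : 0 ≤ r) (hr1 : r ≤ 1) :
    (1 + r) ^ q ≤ 1 + 2 ^ q * r := by
  have h := (convexOn_pow q).2 (show (0 : ℝ) ≤ 1 by norm_num) (show (0 : ℝ) ≤ 2 by norm_num)
    (sub_nonneg.2 hr1) hr (by ring)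
  simp only [smul_eq_mul, one_pow, mul_one] at h
  rw [show 1 - r + r * 2 = 1 + r by ring] at h
  nlinarith

lemma nonpos_of_one_add_mul_sq_pow_le {p q : ℕ} (hp : 3 ≤ p) {C : ℝ} (hC : 0 ≤ C)
    (h : ∀ t : ℝ, 0 < t → t ≤ 1 → (1 + C * t ^ 2) ^ p ≤ (1 + t ^ p) ^ q) : C ≤ 0 := by
  have hbound : ∀ t : ℝ, 0 < t → t ≤ 1 → C ≤ 2 ^ q * t := by
    intro t ht ht1
    have h1 : 1 + C * t ^ 2 ≤ (1 + C * t ^ 2) ^ p :=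
      le_self_pow₀ (le_add_of_nonneg_right (by positivity)) (by lia)
    have h2 := one_add_pow_le q (pow_nonneg ht.le p) (pow_le_one₀ ht.le ht1)
    have h3 : t ^ p ≤ t ^ 3 := pow_le_pow_of_le_one ht.le ht1 hp
    have h4 : C * t ^ 2 ≤ (2 ^ q * t) * t ^ 2 := by
      have := mul_le_mul_of_nonneg_left h3 (by positivity : (0 : ℝ) ≤ 2 ^ q)
      nlinarith [h t ht ht1]
    exact le_of_mul_le_mul_right h4 (by positivity)
  by_contra! hC'
  have hpos : (0 : ℝ) < 2 ^ q := by positivity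
  have ht : 0 < min 1 (C / (2 * 2 ^ q)) := lt_min one_pos (by positivity)
  have h1 := hbound _ ht (min_le_left _ _)
  have h2 := mul_le_mul_of_nonneg_left (min_le_right 1 (C / (2 * 2 ^ q))) hpos.le
  have h3 : (2 : ℝ) ^ q * (C / (2 * 2 ^ q)) = C / 2 := by field_simp
  linarith

/-- There is no linear isometry `ℓ_pⁿ → ℓ_qⁿ` for `p ≠ q`, `p ≥ 3`, `q ≥ 2`, `n ≥ 2`. -/
lemma eq_of_linear_powSum_pow_eq {n p m : ℕ} (hn : 2 ≤ n) (hp : 3 ≤ p)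
    (A : EuclideanSpace ℝ (Fin n) →ₗ[ℝ] EuclideanSpace ℝ (Fin n))
    (hA : ∀ x, powSum (m + 2) (A x) ^ p = powSum p x ^ (m + 2)) : p = m + 2 := by
  have hp0 : p ≠ 0 := by lia
  have hunit : ∀ x, powSum p x = 1 → powSum (m + 2) (A x) = 1 := fun x hx => by
    have := hA x
    rw [hx, one_pow] at this
    exact (pow_eq_one_iff_of_nonneg (powSum_nonneg _ _) hp0).1 this
  obtain ⟨i, j, hij⟩ : ∃ i j : Fin n, i ≠ j := ⟨⟨0, by lia⟩, ⟨1, by lia⟩, by simp⟩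
  set a := A (EuclideanSpace.single i (1 : ℝ)) with ha
  set b := A (EuclideanSpace.single j (1 : ℝ)) with hb
  have ha1 : powSum (m + 2) a = 1 := hunit _ (powSum_single hp0 i)
  have hb1 : powSum (m + 2) b = 1 := hunit _ (powSum_single hp0 j)
  have hplus : ∀ t : ℝ, 0 ≤ t → powSum (m + 2) (a + t • b) ^ p = (1 + t ^ p) ^ (m + 2) := by
    intro t ht
    rw [← powSum_single_add_smul_single hp0 hij ht, ← hA, map_add, map_smul]
  have hminus : ∀ t : ℝ, 0 ≤ t → powSum (m + 2) (a - t • b) = powSum (m + 2) (a + t • b) := by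
    intro t ht
    refine (pow_left_inj₀ (powSum_nonneg _ _) (powSum_nonneg _ _) hp0).1 ?_
    rw [ha, hb, ← map_smul, ← map_sub, ← map_add, hA, hA]
    congr 1
    refine Finset.sum_congr rfl fun l _ => ?_
    rcases eq_or_ne l i with rfl | hl
    · simp [hij]
    · simp [hl]
  set C := ∑ l, |a l| ^ m * b l ^ 2 with hCdef
  have hC0 : 0 ≤ C := Finset.sum_nonneg fun _ _ => by positivity
  have hlower : ∀ t : ℝ, 0 ≤ t → 1 + C * t ^ 2 ≤ powSum (m + 2) (a + t • b) := by
    intro t ht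
    have hsum : 2 * powSum (m + 2) a + 2 * (C * t ^ 2)
        ≤ powSum (m + 2) (a + t • b) + powSum (m + 2) (a - t • b) := by
      simp only [powSum, hCdef, Finset.mul_sum, Finset.sum_mul, ← Finset.sum_add_distrib]
      refine Finset.sum_le_sum fun l _ => ?_
      have := abs_add_pow_add_abs_sub_pow_ge m (a l) (t * b l)
      rw [mul_pow, mul_comm (t ^ 2), ← mul_assoc (|a l| ^ m)] at this
      simpa using this
    rw [hminus t ht, ha1] at hsum
    linarith
  have hC : C = 0 := le_antisymm (nonpos_of_one_add_mul_sq_pow_le hp hC0 fun t ht _ => by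
    rw [← hplus t ht.le]
    exact pow_le_pow_left₀ (by positivity) (hlower t ht.le) p) hC0
  have hdisj : ∀ l, a l = 0 ∨ b l = 0 := fun l => by
    have := (Finset.sum_eq_zero_iff_of_nonneg fun _ _ => by positivity).1 hC l (Finset.mem_univ l)
    rcases mul_eq_zero.1 this with h | h
    · exact Or.inl (abs_eq_zero.1 (eq_zero_of_pow_eq_zero h))
    · exact Or.inr (eq_zero_of_pow_eq_zero h)
  have htwo : powSum (m + 2) (a + (1 : ℝ) • b) = 2 := by
    suffices h : powSum (m + 2) (a + (1 : ℝ) • b) = powSum (m + 2) a + powSum (m + 2) b by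
      rw [h, ha1, hb1, one_add_one_eq_two]
    simp only [powSum, ← Finset.sum_add_distrib]
    refine Finset.sum_congr rfl fun l _ => ?_
    rcases hdisj l with h | h <;> simp [h]
  have hfin := hplus 1 zero_le_one
  rw [htwo, one_pow, one_add_one_eq_two] at hfin
  exact pow_right_injective₀ two_pos (by norm_num) hfin

lemma eq_of_image_coneK_eq {d k k' : ℕ} (hd : 3 ≤ d) (hk : 2 ≤ k) (hk' : 1 ≤ k')
    (T : (ℝ × EuclideanSpace ℝ (Fin (d - 1))) ≃ᵃ[ℝ] (ℝ × EuclideanSpace ℝ (Fin (d - 1))))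
    (hT : T '' coneK d k = coneK d k') : k = k' := by
  have hT0 := map_zero_of_image_coneK hd T hT
  set L := T.linear
  have hTL : ∀ u, T u = L u := fun u => by simpa [hT0] using T.map_vadd 0 u
  have hL : ∀ u, L u ∈ coneK d k' ↔ u ∈ coneK d k := fun u => by
    rw [← hT, ← hTL, T.injective.mem_set_image]
  have hLs : ∀ u, L.symm u ∈ coneK d k ↔ u ∈ coneK d k' := fun u => by
    rw [← hL, L.apply_symm_apply]
  set A : EuclideanSpace ℝ (Fin (d - 1)) →ₗ[ℝ] EuclideanSpace ℝ (Fin (d - 1)) :=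
    LinearMap.snd ℝ _ _ ∘ₗ L.toLinearMap ∘ₗ LinearMap.inr ℝ _ _
  set b := (L (1, 0)).2
  have hsplit : ∀ x, L (1, x) = L (1, 0) + L (0, x) := fun x => by
    rw [← map_add]; simp
  have hbase : ∀ x, powSum (k + 1) x ≤ 1 → L (1, x) = (1, b + A x) := fun x hx => by
    ext1
    · exact fst_map_of_image_coneK L hL hx
    · rw [hsplit]; rfl
  have hmem : ∀ x, powSum (k + 1) x ≤ 1 → powSum (k' + 1) (b + A x) ≤ 1 := fun x hx => by
    rw [← one_mk_mem_coneK, ← hbase x hx, hL, one_mk_mem_coneK]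
    exact hx
  have hsurj : ∀ z, powSum (k' + 1) z ≤ 1 → ∃ x, powSum (k + 1) x ≤ 1 ∧ z = b + A x := by
    intro z hz
    have h1 := fst_map_of_image_coneK L.symm hLs hz
    have heq : L.symm (1, z) = (1, (L.symm (1, z)).2) := Prod.ext h1 rfl
    have hx : powSum (k + 1) (L.symm (1, z)).2 ≤ 1 := by
      rw [← one_mk_mem_coneK, ← heq, hLs, one_mk_mem_coneK]
      exact hz
    refine ⟨_, hx, ?_⟩
    have h2 := hbase _ hx
    rw [← heq, L.apply_symm_apply] at h2
    exact congrArg Prod.snd h2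
  have hb0 : b = 0 := by
    have : (-2 : ℝ) • b = 0 := by
      refine eq_zero_of_translate_mem (q := k' + 1) (by simp) fun z hz => ?_
      obtain ⟨x, hx, rfl⟩ := hsurj z hz
      have := hmem (-x) (by rwa [powSum_neg])
      rw [← powSum_neg] at this
      convert this using 2
      rw [map_neg]
      module
    simpa using this
  have hAinj : Function.Injective A := by
    rw [injective_iff_map_eq_zero]
    intro x hx
    by_contra hx0
    obtain ⟨i, hi⟩ : ∃ i, x i ≠ 0 := by
      by_contra! h
      exact hx0 (by ext i; simpa using h i)
    have hpos : 0 < powSum (k + 1) x :=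
      Finset.sum_pos' (fun _ _ => by positivity)
        ⟨i, Finset.mem_univ i, pow_pos (abs_pos.2 hi) _⟩
    obtain ⟨c, hc, hcx⟩ := exists_pos_pow_mul_eq (p := k + 1) (by simp) hpos one_pos
    have h1 := hbase (c • x) (by rw [powSum_smul _ hc.le, hcx])
    have h2 := hbase 0 (by simp [powSum_zero])
    rw [map_smul, hx, smul_zero] at h1
    rw [map_zero, ← h1] at h2
    have h3 : (0 : EuclideanSpace ℝ (Fin (d - 1))) = c • x :=
      congrArg Prod.snd (L.injective h2)
    exact hx0 ((smul_eq_zero.1 h3.symm).resolve_left hc.ne')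
  simp only [hb0, zero_add] at hmem hsurj
  have hback : ∀ x, powSum (k' + 1) (A x) ≤ 1 → powSum (k + 1) x ≤ 1 := fun x hx => by
    obtain ⟨y, hy, hxy⟩ := hsurj _ hx
    rwa [hAinj hxy]
  have hhomA : ∀ (c : ℝ) x, 0 ≤ c →
      powSum (k' + 1) (A (c • x)) = c ^ (k' + 1) * powSum (k' + 1) (A x) := fun c x hc => by
    rw [map_smul, powSum_smul _ hc]
  have hhom : ∀ (c : ℝ) (x : EuclideanSpace ℝ (Fin (d - 1))), 0 ≤ c →
      powSum (k + 1) (c • x) = c ^ (k + 1) * powSum (k + 1) x := fun c x hc => powSum_smul _ hc x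
  have hiso : ∀ x, powSum (k' + 1) (A x) ^ (k + 1) = powSum (k + 1) x ^ (k' + 1) := fun x =>
    le_antisymm
      (pow_le_pow_of_le_one_imp (by simp) (by simp) (powSum_nonneg _)
        (fun x => powSum_nonneg _ (A x)) hhom hhomA hmem x)
      (pow_le_pow_of_le_one_imp (by simp) (by simp) (fun x => powSum_nonneg _ (A x))
        (powSum_nonneg _) hhomA hhom hback x)
  obtain ⟨m, rfl⟩ : ∃ m, k' = m + 1 := ⟨k' - 1, by lia⟩
  have := eq_of_linear_powSum_pow_eq (m := m) (by lia) (by lia) A hiso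
  lia

/-- for `k ≠ k'`, the cones `K_k` and `K_{k'}` are not affinely
equivalent. -/
theorem stmt_9 (d k k' : ℕ) (hd : 3 ≤ d) (hk : 1 ≤ k) (hk' : 1 ≤ k') (hne : k ≠ k') :
    ¬ ∃ T : (ℝ × EuclideanSpace ℝ (Fin (d - 1))) ≃ᵃ[ℝ]
          (ℝ × EuclideanSpace ℝ (Fin (d - 1))),
        T '' coneK d k = coneK d k' := by
  rintro ⟨T, hT⟩
  rcases hk.eq_or_lt with h | h
  · refine hne (eq_of_image_coneK_eq hd (show 2 ≤ k' by lia) hk T.symm ?_).symm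
    rw [← hT, Set.image_image]
    simp
  · exact hne (eq_of_image_coneK_eq hd h hk' T hT)
end

section
/- For every convex body C in ℝ^d with John point j(C) (center of its John ellipsoid) and Löwner point l(C) (center of its Löwner ellipsoid), if j(C) ≠ l(C) and a is the chord of C through j(C) and l(C), then ‖j(C) − l(C)‖_2 / vol_1(a ∩ C) ≤ 1 − 2/(d+1); equivalently φ_{j,l}(C) ≥ 2/(d+1). -/
open Metric MeasureTheory

abbrev Ed (d : ℕ) := EuclideanSpace ℝ (Fin d)

open Module Filter Topology

section AxialStretch

variable {E : Type*} [NormedAddCommGroup E] [InnerProductSpace ℝ E]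

/-- The linear map stretching by `a` along the unit vector `u` and by `b` on its orthogonal
complement. -/
noncomputable def axialStretch (u : E) (a b : ℝ) : E →ₗ[ℝ] E :=
  b • LinearMap.id + (a - b) • (innerₗ E u).smulRight u

theorem axialStretch_apply (u : E) (a b : ℝ) (x : E) :
    axialStretch u a b x = b • x + ((a - b) * inner ℝ u x) • u := by
  simp [axialStretch, mul_smul]

theorem axialStretch_axialStretch {u : E} (hu : ‖u‖ = 1) (a b a' b' : ℝ) (x : E) :
    axialStretch u a b (axialStretch u a' b' x) = axialStretch u (a * a') (b * b') x := by
  have huu : inner ℝ u u = (1 : ℝ) := by simp [hu]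
  simp only [axialStretch_apply, inner_add_right, inner_smul_right, huu]
  module

theorem axialStretch_one_one (u x : E) : axialStretch u 1 1 x = x := by
  simp [axialStretch_apply]

theorem inner_axialStretch_right (u : E) (a b : ℝ) (x y : E) :
    inner ℝ y (axialStretch u a b x) = inner ℝ (axialStretch u a b y) x := by
  simp only [axialStretch_apply, inner_add_left, inner_add_right, real_inner_smul_left,
    inner_smul_right, real_inner_comm u y]
  ring

theorem norm_axialStretch_sq {u : E} (hu : ‖u‖ = 1) (a b : ℝ) (x : E) :
    ‖axialStretch u a b x‖ ^ 2 = a ^ 2 * inner ℝ u x ^ 2 + b ^ 2 * (‖x‖ ^ 2 - inner ℝ u x ^ 2) := by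
  have huu : inner ℝ u u = (1 : ℝ) := by simp [hu]
  rw [← real_inner_self_eq_norm_sq, ← real_inner_self_eq_norm_sq]
  simp only [axialStretch_apply, inner_add_left, inner_add_right, real_inner_smul_left,
    inner_smul_right, real_inner_comm u x, huu]
  ring

theorem det_axialStretch_mul [FiniteDimensional ℝ E] {u : E} (hu : ‖u‖ = 1) (a : ℝ) {b : ℝ}
    (hb : b ≠ 0) :
    LinearMap.det (axialStretch u a b) * b = a * b ^ finrank ℝ E := by
  have h : axialStretch u a b = b • LinearMap.transvection (innerₗ E u) (((a - b) / b) • u) := by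
    ext x
    simp only [axialStretch_apply, LinearMap.smul_apply, LinearMap.transvection.apply,
      innerₗ_apply_apply, smul_add, smul_smul]
    congr 2
    field_simp
  rw [h, LinearMap.det_smul, LinearMap.transvection.det]
  simp only [innerₗ_apply_apply, inner_smul_right, real_inner_self_eq_norm_sq, hu]
  field_simp
  ring

/-- The affine equivalence carrying the unit ball to the ellipsoid of revolution with center `c`
and axis `u`, of semiaxis `a` along `u` and `b` orthogonally to `u`. -/
noncomputable def revolutionEquiv {u : E} (hu : ‖u‖ = 1) {a b : ℝ} (ha : a ≠ 0) (hb : b ≠ 0)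
    (c : E) : E ≃ᵃ[ℝ] E :=
  (LinearEquiv.ofLinearMap (axialStretch u a b) (axialStretch u a⁻¹ b⁻¹)
    (by ext x; simp [axialStretch_axialStretch hu, ha, hb, axialStretch_one_one])
    (by ext x; simp [axialStretch_axialStretch hu, ha, hb, axialStretch_one_one]))
    |>.toAffineEquiv.trans (AffineEquiv.constVAdd ℝ E c)

theorem revolutionEquiv_apply {u : E} (hu : ‖u‖ = 1) {a b : ℝ} (ha : a ≠ 0) (hb : b ≠ 0)
    (c x : E) : revolutionEquiv hu ha hb c x = c + axialStretch u a b x := rfl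

theorem revolutionEquiv_linear {u : E} (hu : ‖u‖ = 1) {a b : ℝ} (ha : a ≠ 0) (hb : b ≠ 0)
    (c : E) : ((revolutionEquiv hu ha hb c).linear : E →ₗ[ℝ] E) = axialStretch u a b := by
  ext x; rfl

theorem mem_revolutionEquiv_image {u : E} (hu : ‖u‖ = 1) {a b : ℝ} (ha : a ≠ 0) (hb : b ≠ 0)
    {c x : E} (hx : ‖axialStretch u a⁻¹ b⁻¹ (x - c)‖ ≤ 1) :
    x ∈ revolutionEquiv hu ha hb c '' closedBall 0 1 := by
  refine ⟨_, mem_closedBall_zero_iff.2 hx, ?_⟩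
  simp [revolutionEquiv_apply, axialStretch_axialStretch hu, ha, hb, axialStretch_one_one]

end AxialStretch

theorem exists_pos_small_one_lt_mul {m k P : ℝ} (h : m * k < P) :
    ∃ ε : ℝ, 0 < ε ∧ ε < 1 ∧ k * ε < 1 ∧ 1 < (1 + P * ε) * (1 - m * k * ε) := by
  have small (c r : ℝ) (hr : 0 < r) : ∀ᶠ ε : ℝ in 𝓝[>] 0, c * ε < r := by
    have : Tendsto (fun ε : ℝ => c * ε) (𝓝[>] 0) (𝓝 0) :=
      ((continuous_const_mul c).tendsto' 0 0 (mul_zero c)).mono_left nhdsWithin_le_nhds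
    exact this.eventually_lt_const hr
  obtain ⟨ε, h1, h2, h3, h0 : 0 < ε⟩ := ((small 1 1 one_pos).and ((small k 1 one_pos).and
    ((small (P * (m * k)) (P - m * k) (sub_pos.2 h)).and self_mem_nhdsWithin))).exists
  refine ⟨ε, h0, by linarith, h2, ?_⟩
  nlinarith [mul_pos h0 (sub_pos.2 h3)]

theorem map_neg_inv_smul_symm {E : Type*} [AddCommGroup E] [Module ℝ E]
    (T : E ≃ᵃ[ℝ] E) (r : ℝ) (x : E) :
    T (-r⁻¹ • T.symm x) = T 0 - r⁻¹ • (x - T 0) := by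
  have h (w : E) : T w = T.linear w + T 0 := by simpa using T.map_vadd 0 w
  have hx : T.linear (T.symm x) = x - T 0 := by
    rw [eq_sub_iff_add_eq, ← h, T.apply_symm_apply]
  rw [h, map_smul, hx, neg_smul, neg_add_eq_sub]

section Core

variable {E : Type*} [NormedAddCommGroup E] [InnerProductSpace ℝ E] [FiniteDimensional ℝ E]

theorem sq_det_axialStretch {u : E} (hu : ‖u‖ = 1) (a : ℝ) {b : ℝ} (hb : b ≠ 0) :
    LinearMap.det (axialStretch u a b) ^ 2 = a ^ 2 * (b ^ 2) ^ (finrank ℝ E - 1) := by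
  have : Nontrivial E := ⟨u, 0, by rintro rfl; simp at hu⟩
  have hd : finrank ℝ E - 1 + 1 = finrank ℝ E := Nat.sub_add_cancel finrank_pos
  have h := det_axialStretch_mul hu a hb
  rw [← hd, pow_succ, ← mul_assoc] at h
  rw [mul_right_cancel₀ hb h]
  ring

/-- If the unit ball has maximal volume among the ellipsoids in the closed convex set `C`, then
`C` is contained in the concentric ball of radius the dimension. -/
theorem subset_closedBall_of_john {C : Set E} (hC : Convex ℝ C) (hCc : IsClosed C)
    (hd : 2 ≤ finrank ℝ E) (hsub : closedBall 0 1 ⊆ C)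
    (hmax : ∀ S : E ≃ᵃ[ℝ] E, S '' closedBall 0 1 ⊆ C →
      |LinearMap.det (S.linear : E →ₗ[ℝ] E)| ≤ 1) :
    C ⊆ closedBall 0 (finrank ℝ E) := by
  intro x hx
  rw [mem_closedBall_zero_iff]
  by_contra! hR
  set R := ‖x‖ with hRdef
  have hd' : (2 : ℝ) ≤ finrank ℝ E := by exact_mod_cast hd
  have hR0 : 0 < R := by linarith
  have hR1 : 0 < R - 1 := by linarith
  set u : E := R⁻¹ • x with hudef
  have hu : ‖u‖ = 1 := by simp [hudef, norm_smul, ← hRdef, abs_of_pos hR0, hR0.ne']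
  have hxu : x = R • u := by simp [hudef, hR0.ne']
  obtain ⟨m, hm⟩ : ∃ m, finrank ℝ E = m + 1 := ⟨_, (Nat.sub_add_cancel (by lia)).symm⟩
  have hmR : (m : ℝ) < R - 1 := by rw [hm] at hR; push_cast at hR; linarith
  set k := 2 / (R - 1) with hk
  have hk0 : 0 < k := by positivity
  have hkR : k * (R - 1) = 2 := by simp [hk, hR1.ne']
  obtain ⟨ε, h0, h1, hkε, hvol⟩ := exists_pos_small_one_lt_mul (m := m) (k := k) (P := 2)
    (by nlinarith)
  have hb2 : 0 < 1 - k * ε := by linarith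
  set b := √(1 - k * ε) with hb
  have hbsq : b ^ 2 = 1 - k * ε := Real.sq_sqrt hb2.le
  have hb0 : b ≠ 0 := (Real.sqrt_pos.2 hb2).ne'
  have ha0 : 1 + ε ≠ 0 := by positivity
  have hS := hmax (revolutionEquiv hu ha0 hb0 (ε • u)) ?_
  · rw [revolutionEquiv_linear, ← sq_le_one_iff_abs_le_one, sq_det_axialStretch hu _ hb0, hbsq, hm,
      Nat.add_sub_cancel] at hS
    have hbern := one_add_mul_le_pow (a := -(k * ε)) (by linarith) m
    rw [← sub_eq_add_neg] at hbern
    have hp : 0 < (1 - k * ε) ^ m := by positivity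
    nlinarith [sq_nonneg ε]
  · rintro _ ⟨w, hw, rfl⟩
    by_contra hz
    obtain ⟨f, v, hfC, hfz⟩ := geometric_hahn_banach_closed_point hC hCc hz
    obtain ⟨y, rfl⟩ := (InnerProductSpace.toDual ℝ E).surjective f
    simp only [InnerProductSpace.toDual_apply_apply] at hfC hfz
    set p := inner ℝ u y with hp
    set n := ‖y‖ with hn
    have hn0 : 0 ≤ n := norm_nonneg y
    have hpn : |p| ≤ n := by simpa [hu] using abs_real_inner_le_norm u y
    have hnv : n ≤ v := by
      rcases eq_or_ne y 0 with hy | hy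
      · have := hfC 0 (hsub (by simp))
        simp [hn, hy] at this ⊢
        exact this.le
      · have := hfC (n⁻¹ • y) (hsub (by
          simpa [norm_smul, ← hn, abs_of_nonneg hn0] using inv_mul_le_one))
        rw [inner_smul_right, real_inner_self_eq_norm_sq, ← hn] at this
        have hn' : n ≠ 0 := by simpa [hn] using hy
        have e : n⁻¹ * n ^ 2 = n := by field_simp
        linarith
    have hRv : R * p ≤ v := by
      have := hfC x hx
      rw [hxu, inner_smul_right, real_inner_comm] at this
      exact this.le
    rw [revolutionEquiv_apply, inner_add_right, inner_smul_right, real_inner_comm, ← hp,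
      inner_axialStretch_right] at hfz
    have hcs := real_inner_le_norm (axialStretch u (1 + ε) b y) w
    have hw' : ‖w‖ ≤ 1 := by simpa using hw
    have hN := norm_axialStretch_sq hu (1 + ε) b y
    rw [← hp, ← hn, hbsq] at hN
    set N := ‖axialStretch u (1 + ε) b y‖ with hNdef
    have hN0 : 0 ≤ N := norm_nonneg _
    have hlt : v - ε * p < N := by nlinarith
    have hp' := abs_le.1 hpn
    rcases le_total (R * p) n with hc | hc
    · have : N ≤ n - ε * p := by
        apply abs_le_of_sq_le_sq' _ _ |>.2
        · rw [hN]
          have e : (n - ε * p) ^ 2 - ((1 + ε) ^ 2 * p ^ 2 + (1 - k * ε) * (n ^ 2 - p ^ 2))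
              = ε * (n + p) * (k * (n - R * p)) + ε * p * (n + p) * (k * (R - 1) - 2) := by ring
          rw [hkR] at e
          have : 0 ≤ ε * (n + p) * (k * (n - R * p)) := by
            have : 0 ≤ n + p := by linarith
            have : 0 ≤ n - R * p := by linarith
            positivity
          linarith
        · nlinarith
      linarith
    · have hp0 : 0 ≤ p := by
        by_contra! h
        nlinarith
      have : N ≤ (R - ε) * p := by
        apply abs_le_of_sq_le_sq' _ _ |>.2
        · rw [hN]
          have e : ((R - ε) * p) ^ 2 - ((1 + ε) ^ 2 * p ^ 2 + (1 - k * ε) * (n ^ 2 - p ^ 2))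
              = (1 - k * ε) * ((R * p) ^ 2 - n ^ 2) + ε * p ^ 2 * (R + 1) * (k * (R - 1) - 2) := by
            ring
          rw [hkR] at e
          have : 0 ≤ (1 - k * ε) * ((R * p) ^ 2 - n ^ 2) :=
            mul_nonneg hb2.le (by nlinarith)
          linarith
        · exact mul_nonneg (by linarith) hp0
      linarith

/-- If the unit ball has minimal volume among the ellipsoids containing the closed convex set `C`,
then `C` contains the concentric ball of radius the inverse of the dimension. -/
theorem closedBall_subset_of_lowner {C : Set E} (hC : Convex ℝ C) (hCc : IsClosed C)
    (hne : C.Nonempty) (hd : 2 ≤ finrank ℝ E) (hsup : C ⊆ closedBall 0 1)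
    (hmin : ∀ S : E ≃ᵃ[ℝ] E, C ⊆ S '' closedBall 0 1 →
      1 ≤ |LinearMap.det (S.linear : E →ₗ[ℝ] E)|) :
    closedBall 0 (finrank ℝ E : ℝ)⁻¹ ⊆ C := by
  intro z hz
  rw [mem_closedBall_zero_iff] at hz
  by_contra hzC
  obtain ⟨f, v, hfC, hfz⟩ := geometric_hahn_banach_closed_point hC hCc hzC
  obtain ⟨y, rfl⟩ := (InnerProductSpace.toDual ℝ E).surjective f
  simp only [InnerProductSpace.toDual_apply_apply] at hfC hfz
  have hy : y ≠ 0 := by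
    rintro rfl
    obtain ⟨c, hc⟩ := hne
    have := hfC c hc
    simp at this hfz
    linarith
  have hn : 0 < ‖y‖ := norm_pos_iff.2 hy
  set u : E := ‖y‖⁻¹ • y with hudef
  have hu : ‖u‖ = 1 := by simp [hudef, norm_smul, hn.ne']
  have hd0 : (0 : ℝ) < finrank ℝ E := by exact_mod_cast (by lia : 0 < finrank ℝ E)
  obtain ⟨m, hm⟩ : ∃ m, finrank ℝ E = m + 1 := ⟨_, (Nat.sub_add_cancel (by lia)).symm⟩
  set h := ‖y‖⁻¹ * v with hh
  have hCh : ∀ c ∈ C, inner ℝ u c ≤ h := fun c hc => by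
    rw [hudef, real_inner_smul_left]
    exact mul_le_mul_of_nonneg_left (hfC c hc).le (by positivity)
  have hhd : h * finrank ℝ E < 1 := by
    rw [← lt_div_iff₀ hd0, one_div, hh, inv_mul_lt_iff₀ hn]
    calc v < inner ℝ y z := hfz
      _ ≤ ‖y‖ * ‖z‖ := real_inner_le_norm _ _
      _ ≤ _ := by gcongr
  have hh1 : 0 < 1 - h := by
    have : (2 : ℝ) ≤ finrank ℝ E := by exact_mod_cast hd
    nlinarith
  set k := 2 / (1 - h) with hk
  have hk0 : 0 < k := by positivity
  have hkh : k * (1 - h) = 2 := by simp [hk, hh1.ne']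
  obtain ⟨ε, h0, h1, hkε, hvol⟩ := exists_pos_small_one_lt_mul (m := m) (k := k)
    (P := 2 * (m + 1)) (by
      rw [hm] at hhd; push_cast at hhd
      have : (m : ℝ) < (m + 1) * (1 - h) := by linarith
      rw [hk, mul_div_assoc', div_lt_iff₀ hh1]
      linarith)
  have hb2 : 0 < 1 - k * ε := by linarith
  set q := √(1 - k * ε) with hq
  have hqsq : q ^ 2 = 1 - k * ε := Real.sq_sqrt hb2.le
  have hq0 : q ≠ 0 := (Real.sqrt_pos.2 hb2).ne'
  have ha0 : 1 - ε ≠ 0 := by linarith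
  have hap : 0 < 1 - ε := by linarith
  have hb0 : (1 - ε) / q ≠ 0 := div_ne_zero ha0 hq0
  have hS := hmin (revolutionEquiv hu ha0 hb0 (-ε • u)) ?_
  · rw [revolutionEquiv_linear, ← one_le_sq_iff_one_le_abs, sq_det_axialStretch hu _ hb0, div_pow,
      hqsq, hm, Nat.add_sub_cancel, div_pow, ← pow_mul, mul_div_assoc', ← pow_add,
      one_le_div (by positivity)] at hS
    have hbern := one_add_mul_le_pow (a := -(k * ε)) (by linarith) m
    rw [← sub_eq_add_neg] at hbern
    have hbern' := one_add_mul_le_pow (a := ε) (by linarith) (2 + 2 * m)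
    push_cast at hbern'
    have hprod : (1 + ε) ^ (2 + 2 * m) * (1 - ε) ^ (2 + 2 * m) ≤ 1 := by
      rw [← mul_pow]
      exact pow_le_one₀ (by nlinarith) (by nlinarith)
    have hpos : 0 < (1 + ε) ^ (2 + 2 * m) := by positivity
    have hpp : 0 < 1 + 2 * (m + 1) * ε := by positivity
    nlinarith [mul_le_mul_of_nonneg_left hS hpos.le, mul_le_mul_of_nonneg_left hbern hpp.le,
      mul_le_mul_of_nonneg_right hbern' (pow_pos hb2 m).le]
  · intro x hx
    apply mem_revolutionEquiv_image
    rw [← sq_le_one_iff₀ (norm_nonneg _), norm_axialStretch_sq hu]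
    have huu : inner ℝ u u = (1 : ℝ) := by simp [hu]
    have hx1 : ‖x‖ ≤ 1 := by simpa using hsup hx
    have hs := hCh x hx
    have hsn : |inner ℝ u x| ≤ ‖x‖ := by simpa [hu] using abs_real_inner_le_norm u x
    have hin : inner ℝ u (x - -ε • u) = inner ℝ u x + ε := by
      rw [inner_sub_right, inner_smul_right, huu]; ring
    have hnorm : ‖x - -ε • u‖ ^ 2 = ‖x‖ ^ 2 + 2 * ε * inner ℝ u x + ε ^ 2 := by
      rw [neg_smul, sub_neg_eq_add, norm_add_sq_real, inner_smul_right, real_inner_comm,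
        norm_smul, hu, Real.norm_eq_abs, mul_one, sq_abs]
      ring
    rw [hin, hnorm, inv_pow, inv_pow, div_pow, hqsq, inv_div]
    set s := inner ℝ u x
    have hs1 := abs_le.1 hsn
    rw [inv_mul_eq_div, div_mul_eq_mul_div, ← add_div, div_le_one (by positivity)]
    have e : (1 - ε) ^ 2 - ((s + ε) ^ 2 + (1 - k * ε) *
        (‖x‖ ^ 2 + 2 * ε * s + ε ^ 2 - (s + ε) ^ 2)) =
        (1 - k * ε) * (1 - ‖x‖ ^ 2) + ε * ((1 + s) * (k * (h - s)))
          + ε * (1 + s) * (k * (1 - h) - 2) := by ring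
    rw [hkh] at e
    have h2 : 0 ≤ ε * ((1 + s) * (k * (h - s))) := by
      have : 0 ≤ 1 + s := by linarith
      have : 0 ≤ h - s := by linarith
      positivity
    have h3 : 0 ≤ (1 - k * ε) * (1 - ‖x‖ ^ 2) :=
      mul_nonneg hb2.le (by nlinarith [norm_nonneg x])
    linarith

variable [MeasurableSpace E] [BorelSpace E]

theorem volume_image_affineEquiv (T : E ≃ᵃ[ℝ] E) (s : Set E) :
    volume (T '' s) = ENNReal.ofReal |LinearMap.det (T.linear : E →ₗ[ℝ] E)| * volume s := by
  have h : T '' s = (fun x => x + T 0) '' ((T.linear : E →ₗ[ℝ] E) '' s) := by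
    rw [Set.image_image]
    refine Set.image_congr fun x _ => ?_
    simpa using T.map_vadd 0 x
  rw [h, Set.image_add_right, measure_preimage_add_right, Measure.addHaar_image_linearMap]

theorem volume_trans_image_closedBall_le_iff (S S' T : E ≃ᵃ[ℝ] E) :
    volume (S.trans T '' closedBall 0 1) ≤ volume (S'.trans T '' closedBall 0 1) ↔
      |LinearMap.det (S.linear : E →ₗ[ℝ] E)| ≤ |LinearMap.det (S'.linear : E →ₗ[ℝ] E)| := by
  have hB0 : volume (closedBall (0 : E) 1) ≠ 0 := (measure_closedBall_pos _ _ one_pos).ne'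
  have hBt : volume (closedBall (0 : E) 1) ≠ ⊤ := measure_closedBall_lt_top.ne
  have hT : ENNReal.ofReal |LinearMap.det (T.linear : E →ₗ[ℝ] E)| ≠ 0 := by
    simpa using (LinearEquiv.isUnit_det' T.linear).ne_zero
  rw [AffineEquiv.coe_trans, AffineEquiv.coe_trans, Set.image_comp, Set.image_comp,
    volume_image_affineEquiv T, volume_image_affineEquiv T, volume_image_affineEquiv S,
    volume_image_affineEquiv S', ENNReal.mul_le_mul_iff_right hT ENNReal.ofReal_ne_top,
    ENNReal.mul_le_mul_iff_left hB0 hBt, ENNReal.ofReal_le_ofReal_iff (abs_nonneg _)]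

/-- The center of the John ellipsoid of `C` splits every chord through it in a ratio at most the
dimension. -/
theorem john_center_reflect_mem {C : Set E} (hC : Convex ℝ C) (hCc : IsClosed C)
    (hd : 2 ≤ finrank ℝ E) (T : E ≃ᵃ[ℝ] E) (hsub : T '' closedBall 0 1 ⊆ C)
    (hmax : ∀ S : E ≃ᵃ[ℝ] E, S '' closedBall 0 1 ⊆ C →
      volume (S '' closedBall 0 1) ≤ volume (T '' closedBall 0 1))
    {x : E} (hx : x ∈ C) : T 0 - (finrank ℝ E : ℝ)⁻¹ • (x - T 0) ∈ C := by
  have key := subset_closedBall_of_john (C := T ⁻¹' C) (hC.affine_preimage (T : E →ᵃ[ℝ] E))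
    (hCc.preimage T.continuous_of_finiteDimensional) hd (Set.image_subset_iff.1 hsub)
    (fun S hS => by
      have h := hmax (S.trans T) (by
        rw [AffineEquiv.coe_trans, Set.image_comp, Set.image_subset_iff]; exact hS)
      rw [← AffineEquiv.refl_trans T, ← AffineEquiv.trans_assoc, AffineEquiv.trans_refl] at h
      simpa using (volume_trans_image_closedBall_le_iff S _ T).1 h)
  have hx' := key (show T.symm x ∈ T ⁻¹' C by simpa using hx)
  rw [mem_closedBall_zero_iff] at hx'
  rw [← map_neg_inv_smul_symm]
  refine hsub ⟨_, ?_, rfl⟩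
  rw [mem_closedBall_zero_iff, norm_smul, norm_neg, norm_inv, Real.norm_natCast]
  exact inv_mul_le_one_of_le₀ hx' (Nat.cast_nonneg _)

/-- The center of the Löwner ellipsoid of `C` splits every chord through it in a ratio at most the
dimension. -/
theorem lowner_center_reflect_mem {C : Set E} (hC : Convex ℝ C) (hCc : IsClosed C)
    (hd : 2 ≤ finrank ℝ E) (T : E ≃ᵃ[ℝ] E) (hsup : C ⊆ T '' closedBall 0 1)
    (hmin : ∀ S : E ≃ᵃ[ℝ] E, C ⊆ S '' closedBall 0 1 →
      volume (T '' closedBall 0 1) ≤ volume (S '' closedBall 0 1))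
    {x : E} (hx : x ∈ C) : T 0 - (finrank ℝ E : ℝ)⁻¹ • (x - T 0) ∈ C := by
  have hxT : T.symm x ∈ T ⁻¹' C := by simpa using hx
  have hsup' : T ⁻¹' C ⊆ closedBall 0 1 := fun y hy => by
    obtain ⟨w, hw, hwy⟩ := hsup hy
    rwa [← T.injective hwy]
  have key := closedBall_subset_of_lowner (hC.affine_preimage (T : E →ᵃ[ℝ] E))
    (hCc.preimage T.continuous_of_finiteDimensional) ⟨_, hxT⟩ hd hsup'
    (fun S hS => by
      have h := hmin (S.trans T) (by
        rw [AffineEquiv.coe_trans, Set.image_comp]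
        exact fun y hy => ⟨T.symm y, hS (by simpa using hy), by simp⟩)
      rw [← AffineEquiv.refl_trans T, ← AffineEquiv.trans_assoc, AffineEquiv.trans_refl] at h
      simpa using (volume_trans_image_closedBall_le_iff _ S T).1 h)
  rw [← map_neg_inv_smul_symm]
  refine key ?_
  have := mem_closedBall_zero_iff.1 (hsup' hxT)
  rw [mem_closedBall_zero_iff, norm_smul, norm_neg, norm_inv, Real.norm_natCast]
  exact mul_le_of_le_one_right (by positivity) this

end Core

/-- if `j` is the center of the John ellipsoid and `l` the center of the
Löwner ellipsoid of a convex body `C`, and `j ≠ l`, then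
`‖j − l‖ ≤ (1 − 2/(d+1)) · vol₁(a ∩ C)` where `a` is the chord of `C` through `j, l`. -/
theorem stmt_11 (d : ℕ) (hd : 2 ≤ d) (C : Set (Ed d))
    (hCconv : Convex ℝ C) (hCc : IsCompact C) (hCint : (interior C).Nonempty)
    (Tj Tl : Ed d ≃ᵃ[ℝ] Ed d)
    -- `Tj` sends the unit ball to the John (maximal volume) ellipsoid of `C`
    (hTj_sub : Tj '' Metric.closedBall (0 : Ed d) 1 ⊆ C)
    (hTj_max : ∀ S : Ed d ≃ᵃ[ℝ] Ed d, S '' Metric.closedBall (0 : Ed d) 1 ⊆ C →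
      volume (S '' Metric.closedBall (0 : Ed d) 1) ≤
        volume (Tj '' Metric.closedBall (0 : Ed d) 1))
    -- `Tl` sends the unit ball to the Löwner (minimal volume) ellipsoid of `C`
    (hTl_sup : C ⊆ Tl '' Metric.closedBall (0 : Ed d) 1)
    (hTl_min : ∀ S : Ed d ≃ᵃ[ℝ] Ed d, C ⊆ S '' Metric.closedBall (0 : Ed d) 1 →
      volume (Tl '' Metric.closedBall (0 : Ed d) 1) ≤
        volume (S '' Metric.closedBall (0 : Ed d) 1))
    (j l : Ed d) (hj : j = Tj 0) (hl : l = Tl 0) (hjl : j ≠ l) :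
    ‖j - l‖ ≤ (1 - 2 / ((d : ℝ) + 1)) *
      ((volume {t : ℝ | j + t • (l - j) ∈ C}).toReal * ‖l - j‖) := by
  have hfin : finrank ℝ (Ed d) = d := by simp
  have hd2 : 2 ≤ finrank ℝ (Ed d) := by rwa [hfin]
  have hv : l - j ≠ 0 := sub_ne_zero.2 hjl.symm
  have hJ {x : Ed d} (hx : x ∈ C) : j - (d : ℝ)⁻¹ • (x - j) ∈ C := by
    have := john_center_reflect_mem hCconv hCc.isClosed hd2 Tj hTj_sub hTj_max hx
    rwa [hfin, ← hj] at this
  have hL {x : Ed d} (hx : x ∈ C) : l - (d : ℝ)⁻¹ • (x - l) ∈ C := by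
    have := lowner_center_reflect_mem hCconv hCc.isClosed hd2 Tl hTl_sup hTl_min hx
    rwa [hfin, ← hl] at this
  have hjC : j ∈ C := hTj_sub ⟨0, by simp, hj.symm⟩
  set I : Set ℝ := {t : ℝ | j + t • (l - j) ∈ C} with hI
  have hIc : IsCompact I :=
    ((Homeomorph.addLeft j).isClosedEmbedding.comp
      (isClosedEmbedding_smul_left hv)).isCompact_preimage hCc
  have hIne : I.Nonempty := ⟨0, by simpa [hI] using hjC⟩
  have hIconv : Convex ℝ I := fun s hs t ht a b ha hb hab => by
    have h := hCconv hs ht ha hb hab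
    rw [hI, Set.mem_ofPred_eq]
    convert h using 1
    obtain rfl : a = 1 - b := by linarith
    simp only [smul_eq_mul]
    module
  obtain ⟨A, hA, hAmin⟩ := hIc.exists_isLeast hIne
  obtain ⟨B, hB, hBmax⟩ := hIc.exists_isGreatest hIne
  have hAJ : A ≤ -((d : ℝ)⁻¹ * B) := hAmin <| by
    rw [hI, Set.mem_ofPred_eq]
    convert hJ hB using 1
    module
  have hBL : 1 - (d : ℝ)⁻¹ * (A - 1) ≤ B := hBmax <| by
    rw [hI, Set.mem_ofPred_eq]
    convert hL hA using 1
    module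
  have hvol : B - A ≤ (volume I).toReal := by
    rw [← ENNReal.ofReal_le_iff_le_toReal hIc.measure_lt_top.ne, ← Real.volume_Icc]
    exact measure_mono (hIconv.ordConnected.out hA hB)
  have hd' : (2 : ℝ) ≤ d := by exact_mod_cast hd
  have hAJ' : (d : ℝ) * A ≤ -B := by
    have := mul_le_mul_of_nonneg_left hAJ (by linarith : (0 : ℝ) ≤ d)
    rwa [mul_neg, mul_inv_cancel_left₀ (by linarith)] at this
  have hBL' : d - (A - 1) ≤ d * B := by
    have := mul_le_mul_of_nonneg_left hBL (by linarith : (0 : ℝ) ≤ d)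
    rwa [mul_sub, mul_one, mul_inv_cancel_left₀ (by linarith)] at this
  have hlen : 1 ≤ (1 - 2 / ((d : ℝ) + 1)) * (volume I).toReal := by
    rw [one_sub_div (by linarith), div_mul_eq_mul_div, one_le_div (by linarith)]
    nlinarith
  rw [norm_sub_rev j l, ← mul_assoc]
  exact le_mul_of_one_le_left (norm_nonneg _) hlen
end
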